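/- Under the hypotheses of the under-approximation theorem (f continuous, Lipschitz in x uniformly in (s,u), U compact nonempty, f(s,x,U) convex; v̄ : [0,T] × ℝⁿ → ℝ continuous, a viscosity supersolution of −v_t + H(t,x,∇v) = 0 with H(t,x,p) = max_{u∈U} ⟨−p, f(t,x,u)⟩ on Ω = {(t,x) ∈ (0,T) × ℝⁿ | v̄(t,x) < 0}, with x ↦ v̄(t,x) of class Z for every t, v̄(T,·) = ḡ and ḡ > 0 outside 𝒳 = {g ≤ 0}), define 𝒢̲(t) = {x ∈ ℝⁿ | v̄(t,x) ≤ 0}. Then for any t₁, t₂ ∈ [0,T] with t₁ ≤ t₂ and any x̄ ∈ 𝒢̲(t₁), there exists a measurable control ū : [t₁,t₂] → U such that φ(t₂; t₁, x̄, ū) ∈ 𝒢̲(t₂). -/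

import Mathlib

open scoped RealInnerProductSpace
open Set

noncomputable section

/-- A function `z` is of class `Z` if for every `x̄` with `z x̄ = 0` and every `r > 0`
there is a point of the open ball `B_r(x̄)` where `z` is negative. -/
def ClassZ {E : Type*} [NormedAddCommGroup E] (z : E → ℝ) : Prop :=
  ∀ x : E, z x = 0 → ∀ r : ℝ, 0 < r → ∃ y ∈ Metric.ball x r, z y < 0

/-- A measurable control valued in `U` on `[t, T]`. -/
def Admissible {α : Type*} [MeasurableSpace α] (U : Set α) (t T : ℝ) (u : ℝ → α) : Prop :=
  Measurable u ∧ ∀ s ∈ Set.Icc t T, u s ∈ U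

/-- `X` is the (absolutely continuous) trajectory of `ẋ(s) = f(s, x(s), u(s))` on `[t, T]`
with `X t = x`, written in integral form. -/
def IsTraj {n m : ℕ} (f : ℝ → EuclideanSpace ℝ (Fin n) → (Fin m → ℝ) → EuclideanSpace ℝ (Fin n))
    (t T : ℝ) (x : EuclideanSpace ℝ (Fin n)) (u : ℝ → (Fin m → ℝ))
    (X : ℝ → EuclideanSpace ℝ (Fin n)) : Prop :=
  ContinuousOn X (Set.Icc t T) ∧
    ∀ s ∈ Set.Icc t T, X s = x + ∫ r in t..s, f r (X r) (u r)

/-- The backwards reachable set at time `t` of the target `{g ≤ 0}` at time `T`. -/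
def Reach {n m : ℕ} (U : Set (Fin m → ℝ))
    (f : ℝ → EuclideanSpace ℝ (Fin n) → (Fin m → ℝ) → EuclideanSpace ℝ (Fin n))
    (g : EuclideanSpace ℝ (Fin n) → ℝ) (T t : ℝ) : Set (EuclideanSpace ℝ (Fin n)) :=
  {x | ∃ u X, Admissible U t T u ∧ IsTraj f t T x u X ∧ g (X T) ≤ 0}

/-- `(pt, px)` is a Fréchet subgradient of `w` at `(t₀, x₀)`:
the liminf as `(t,x) → (t₀,x₀)` of
`[w(t,x) − w(t₀,x₀) − ⟨(pt,px), (t,x) − (t₀,x₀)⟩]/‖(t,x) − (t₀,x₀)‖` is nonnegative. -/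
def IsSubGrad {n : ℕ} (w : ℝ → EuclideanSpace ℝ (Fin n) → ℝ) (t₀ : ℝ)
    (x₀ : EuclideanSpace ℝ (Fin n)) (pt : ℝ) (px : EuclideanSpace ℝ (Fin n)) : Prop :=
  ∀ ε : ℝ, 0 < ε →
    ∀ᶠ z : ℝ × EuclideanSpace ℝ (Fin n) in nhdsWithin (t₀, x₀) {(t₀, x₀)}ᶜ,
      -(ε * ‖(z.1 - t₀, z.2 - x₀)‖) ≤
        w z.1 z.2 - w t₀ x₀ - (pt * (z.1 - t₀) + ⟪px, z.2 - x₀⟫)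

lemma aux_meas_sel {α : Type*} [MeasurableSpace α] {m : ℕ} {U : Set (Fin m → ℝ)}
    (hUc : IsCompact U) (hUne : U.Nonempty) (φ : α → (Fin m → ℝ) → ℝ)
    (hφm : ∀ u ∈ U, Measurable (fun s => φ s u)) (hφc : ∀ s, ContinuousOn (φ s) U)
    (hφ0 : ∀ s, ∀ u ∈ U, 0 ≤ φ s u) (hex : ∀ s, ∃ u ∈ U, φ s u = 0) :
    ∃ u : α → (Fin m → ℝ), Measurable u ∧ ∀ s, u s ∈ U ∧ φ s (u s) = 0 := by
  have : Nonempty U := hUne.to_subtype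
  have : CompactSpace U := isCompact_iff_compactSpace.mp hUc
  have : CompactSpace cantorSet := isCompact_iff_compactSpace.mp isCompact_cantorSet
  obtain ⟨γ0, hγ0c, hγ0s⟩ := exists_nat_bool_continuous_surjective_of_compact U
  let γ : cantorSet → U := γ0 ∘ cantorSetHomeomorphNatToBool
  have hγc : Continuous γ := hγ0c.comp (Homeomorph.continuous _)
  have hγs : Function.Surjective γ := hγ0s.comp (Homeomorph.surjective _)
  let ψ : α → cantorSet → ℝ := fun s a => φ s (γ a)
  have hψc : ∀ s, Continuous (ψ s) := fun s =>
    (hφc s).comp_continuous (continuous_subtype_val.comp hγc) (fun a => (γ a).2)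
  have hψm : ∀ a, Measurable (fun s => ψ s a) := fun a => hφm _ (γ a).2
  have hψ0 : ∀ s a, 0 ≤ ψ s a := fun s a => hφ0 s _ (γ a).2
  have hmin : ∀ s, ∃ a, ψ s a = 0 ∧ ∀ b, ψ s b = 0 → (a : ℝ) ≤ b := by
    intro s
    have hc : IsCompact {a | ψ s a = 0} :=
      (isClosed_eq (hψc s) continuous_const).isCompact
    have hne : {a | ψ s a = 0}.Nonempty := by
      obtain ⟨u, hu, h0⟩ := hex s
      obtain ⟨a, ha⟩ := hγs ⟨u, hu⟩
      exact ⟨a, by simp [ψ, ha, h0]⟩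
    obtain ⟨a, ha, hb⟩ := hc.exists_isMinOn hne continuous_subtype_val.continuousOn
    exact ⟨a, ha, fun b hb' => hb hb'⟩
  choose μ hμ0 hμm using hmin
  have hmeas : Measurable (fun s => (μ s : ℝ)) := by
    refine measurable_of_Iic fun c => ?_
    let D : Set cantorSet := {a | (a : ℝ) ≤ c}
    have hDc : IsCompact D := (isClosed_le continuous_subtype_val continuous_const).isCompact
    obtain ⟨Q, hQc, hQd⟩ := TopologicalSpace.exists_countable_dense D
    have key : (fun s => (μ s : ℝ)) ⁻¹' Iic c
        = ⋂ k : ℕ, ⋃ a ∈ Q, {s | ψ s (a : cantorSet) < 1 / ((k : ℝ) + 1)} := by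
      ext s
      simp only [mem_preimage, mem_Iic, mem_iInter, mem_iUnion, mem_ofPred_eq, exists_prop]
      constructor
      · intro h k
        have hk : (0 : ℝ) < 1 / ((k : ℝ) + 1) := by positivity
        have ho : IsOpen {a : D | ψ s (a : cantorSet) < 1 / ((k : ℝ) + 1)} :=
          isOpen_lt ((hψc s).comp continuous_subtype_val) continuous_const
        obtain ⟨a, ha, hq⟩ := hQd.exists_mem_open ho ⟨⟨μ s, h⟩, by simpa [hμ0 s] using hk⟩
        exact ⟨a, ha, hq⟩
      · intro h
        have hne : D.Nonempty := by
          obtain ⟨a, -, -⟩ := h 0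
          exact ⟨a, a.2⟩
        obtain ⟨a, haD, ha⟩ := hDc.exists_isMinOn hne (hψc s).continuousOn
        have h0 : ψ s a = 0 := by
          refine le_antisymm ?_ (hψ0 s a)
          refine le_of_forall_pos_le_add fun ε hε => ?_
          obtain ⟨k, hk⟩ := exists_nat_one_div_lt hε
          obtain ⟨b, -, hb⟩ := h k
          have : ψ s a ≤ ψ s b := ha b.2
          linarith
        exact (hμm s a h0).trans haD
    rw [key]
    refine MeasurableSet.iInter fun k => MeasurableSet.biUnion hQc fun a _ => ?_
    exact measurableSet_lt (hψm _) measurable_const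
  have hmeas' : Measurable μ := by
    have := Measurable.subtype_mk (p := fun x => x ∈ cantorSet) hmeas (h := fun s => (μ s).2)
    exact this
  refine ⟨fun s => γ (μ s), ?_, fun s => ⟨(γ (μ s)).2, hμ0 s⟩⟩
  exact measurable_subtype_coe.comp (hγc.measurable.comp hmeas')

lemma aux_ftc {n : ℕ} {X : ℝ → EuclideanSpace ℝ (Fin n)} {C : NNReal} (hX : LipschitzWith C X)
    (a b : ℝ) : ∫ r in a..b, deriv X r = X b - X a := by
  have hint : IntervalIntegrable (deriv X) MeasureTheory.volume a b := by
    refine intervalIntegrable_const (c := (C : ℝ)) |>.mono_fun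
      (measurable_deriv X).aestronglyMeasurable ?_
    refine Filter.Eventually.of_forall fun r => ?_
    refine le_trans ?_ (le_abs_self (C : ℝ))
    exact norm_deriv_le_of_lipschitz hX
  ext i
  have h1 := (EuclideanSpace.proj (𝕜 := ℝ) i : EuclideanSpace ℝ (Fin n) →L[ℝ] ℝ).intervalIntegral_comp_comm hint
  have hL : LipschitzWith C (fun r => X r i) := by
    refine LipschitzWith.of_dist_le_mul fun x y => ?_
    refine le_trans ?_ (hX.dist_le_mul x y)
    rw [dist_eq_norm, dist_eq_norm]
    exact PiLp.norm_apply_le (X x - X y) i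
  have hac : AbsolutelyContinuousOnInterval (fun r => X r i) a b :=
    (hL.lipschitzOnWith).absolutelyContinuousOnInterval
  have h2 := hac.integral_deriv_eq_sub
  refine h1.symm.trans ?_
  refine Eq.trans ?_ h2
  refine intervalIntegral.integral_congr_ae ?_
  filter_upwards [hX.ae_differentiableAt_real] with r hr _
  have := ((EuclideanSpace.proj (𝕜 := ℝ) i : EuclideanSpace ℝ (Fin n) →L[ℝ] ℝ).hasFDerivAt.comp_hasDerivAt r hr.hasDerivAt).deriv
  simpa [Function.comp_def] using this.symm

lemma aux_traj {n m : ℕ} {T : ℝ} {U : Set (Fin m → ℝ)} (hUc : IsCompact U) (hUne : U.Nonempty)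
    {f : ℝ → EuclideanSpace ℝ (Fin n) → (Fin m → ℝ) → EuclideanSpace ℝ (Fin n)}
    (hfc : ContinuousOn
      (fun z : ℝ × EuclideanSpace ℝ (Fin n) × (Fin m → ℝ) => f z.1 z.2.1 z.2.2)
      (Set.Icc 0 T ×ˢ (Set.univ : Set (EuclideanSpace ℝ (Fin n))) ×ˢ U))
    {t₁ t₂ : ℝ} (h1 : 0 ≤ t₁) (h2 : t₂ ≤ T)
    {X : ℝ → EuclideanSpace ℝ (Fin n)} {C : NNReal} (hX : LipschitzWith C X)
    (hin : ∀ s ∈ Ioo t₁ t₂, DifferentiableAt ℝ X s → deriv X s ∈ f s (X s) '' U) :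
    ∃ u, Admissible U t₁ t₂ u ∧ IsTraj f t₁ t₂ (X t₁) u X := by
  classical
  let G : Set ℝ := Ioo t₁ t₂ ∩ {s | DifferentiableAt ℝ X s}
  have hG : MeasurableSet G := measurableSet_Ioo.inter (measurableSet_of_differentiableAt ℝ X)
  have hGs : ∀ s ∈ G, s ∈ Icc 0 T := fun s hs => ⟨h1.trans hs.1.1.le, hs.1.2.le.trans h2⟩
  obtain ⟨u, hum, hu⟩ := aux_meas_sel hUc hUne
    (fun s w => if s ∈ G then ‖f s (X s) w - deriv X s‖ else 0) (by
      intro w hw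
      have hF : ContinuousOn (fun s => f s (X s) w) (Icc 0 T) :=
        hfc.comp (f := fun s => (s, X s, w))
          (continuous_id.prodMk (hX.continuous.prodMk continuous_const)).continuousOn
          (fun s hs => ⟨hs, mem_univ _, hw⟩)
      have hF' : Measurable ((Icc 0 T).piecewise (fun s => f s (X s) w) (fun _ => 0)) :=
        hF.measurable_piecewise continuousOn_const measurableSet_Icc
      have := (((hF'.sub (measurable_deriv X)).norm).indicator hG)
      convert this using 2 with s
      by_cases hs : s ∈ G
      · have h' := hGs s hs
        simp only [Set.indicator, hs, if_true, Pi.sub_apply, Set.piecewise, h']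
      · simp only [Set.indicator, hs, if_false]) (by
      intro s
      by_cases hs : s ∈ G
      · simp only [hs, if_true]
        refine ContinuousOn.norm (ContinuousOn.sub ?_ continuousOn_const)
        exact hfc.comp (f := fun w => (s, X s, w)) (by fun_prop)
          (fun w hw => ⟨hGs s hs, mem_univ _, hw⟩)
      · simp only [hs, if_false]
        exact continuousOn_const) (by
      intro s w _
      split_ifs
      · exact norm_nonneg _
      · exact le_rfl) (by
      intro s
      by_cases hs : s ∈ G
      · obtain ⟨w, hw, he⟩ := hin s hs.1 hs.2
        exact ⟨w, hw, by simp [hs, he]⟩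
      · obtain ⟨w, hw⟩ := hUne
        exact ⟨w, hw, by simp [hs]⟩)
  refine ⟨u, ⟨hum, fun s _ => (hu s).1⟩, hX.continuous.continuousOn, fun s hs => ?_⟩
  have hI : ∫ r in t₁..s, f r (X r) (u r) = ∫ r in t₁..s, deriv X r := by
    refine intervalIntegral.integral_congr_ae ?_
    have hne : ∀ᵐ r ∂(MeasureTheory.volume : MeasureTheory.Measure ℝ), r ≠ t₂ := by
      simp [MeasureTheory.ae_iff]
    filter_upwards [hX.ae_differentiableAt_real, hne] with r hr hr2 hrs
    rw [uIoc_of_le hs.1] at hrs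
    have hrG : r ∈ G := ⟨⟨hrs.1, lt_of_le_of_ne (hrs.2.trans hs.2) hr2⟩, hr⟩
    have := (hu r).2
    simp only [hrG, if_true, norm_eq_zero] at this
    exact sub_eq_zero.mp this
  rw [hI, aux_ftc hX]
  abel

lemma aux_disc {E : Type*} [NormedAddCommGroup E] [NormedSpace ℝ E] {N : ℕ} {h M : ℝ}
    (hh : 0 ≤ h) {x v : ℕ → E} (hx : ∀ i < N, x (i+1) = x i + h • v i) (hv : ∀ i < N, ‖v i‖ ≤ M)
    {i j : ℕ} (hij : i ≤ j) (hj : j ≤ N) : ‖x j - x i‖ ≤ M * (j * h - i * h) := by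
  induction j, hij using Nat.le_induction with
  | base => simp
  | succ j hij ih =>
    have h1 := ih (by omega)
    have h2 : x (j+1) - x i = (x j - x i) + h • v j := by rw [hx j (by omega)]; abel
    have h3 : ‖h • v j‖ ≤ h * M := by
      rw [norm_smul, Real.norm_of_nonneg hh]
      exact mul_le_mul_of_nonneg_left (hv j (by omega)) hh
    rw [h2]
    refine (norm_add_le _ _).trans ?_
    push_cast
    linarith

lemma aux_disc2 {E : Type*} [NormedAddCommGroup E] [NormedSpace ℝ E] {N : ℕ} {h α : ℝ}
    (hh : 0 ≤ h) {x v : ℕ → E} (hx : ∀ i < N, x (i+1) = x i + h • v i) (l : E →L[ℝ] ℝ)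
    {i j : ℕ} (hij : i ≤ j) (hj : j ≤ N) (hv : ∀ k, i ≤ k → k < j → l (v k) ≤ α) :
    l (x j - x i) ≤ α * (j * h - i * h) := by
  induction j, hij using Nat.le_induction with
  | base => simp
  | succ j hij ih =>
    have h1 := ih (by omega) (fun k hk hk' => hv k hk (by omega))
    have h2 : x (j+1) - x i = (x j - x i) + h • v j := by rw [hx j (by omega)]; abel
    have h3 : h * l (v j) ≤ h * α := mul_le_mul_of_nonneg_left (hv j hij (by omega)) hh
    rw [h2, map_add, map_smul, smul_eq_mul]
    push_cast
    linarith

lemma aux_step {n m : ℕ} {T : ℝ} {U : Set (Fin m → ℝ)}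
    {f : ℝ → EuclideanSpace ℝ (Fin n) → (Fin m → ℝ) → EuclideanSpace ℝ (Fin n)}
    {vbar : ℝ → EuclideanSpace ℝ (Fin n) → ℝ}
    {t₁ t₂ M δ : ℝ} (hM : 0 ≤ M) (h12 : t₁ ≤ t₂) {xbar : EuclideanSpace ℝ (Fin n)}
    (hE : ∃ (N : ℕ) (h : ℝ) (x : ℕ → EuclideanSpace ℝ (Fin n)), 0 < h ∧ h ≤ δ ∧
      |N * h - (t₂ - t₁)| ≤ δ ∧ ‖x 0 - xbar‖ ≤ δ ∧
      (∀ i < N, ∃ s y u, s ∈ Icc 0 T ∧ u ∈ U ∧ |s - (t₁ + i * h)| ≤ δ ∧ ‖y - x i‖ ≤ δ ∧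
        x (i+1) = x i + h • f s y u ∧ ‖f s y u‖ ≤ M) ∧
      ∃ σ ∈ Icc 0 T, ∃ y, |σ - t₂| ≤ δ ∧ ‖y - x N‖ ≤ δ ∧ vbar σ y ≤ 0) :
    ∃ Y : ℝ → EuclideanSpace ℝ (Fin n), ‖Y t₁ - xbar‖ ≤ δ ∧
      (∀ s s', t₁ ≤ s → s ≤ s' → s' ≤ t₂ → ‖Y s' - Y s‖ ≤ M * ((s' - s) + 4 * δ)) ∧
      (∀ s s', t₁ ≤ s → s ≤ s' → s' ≤ t₂ → ∀ (l : EuclideanSpace ℝ (Fin n) →L[ℝ] ℝ) (α : ℝ),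
        (∀ r ∈ Icc 0 T, |r - s| ≤ (s' - s) + 3 * δ → ∀ z, ‖z - Y s‖ ≤ M * ((s' - s) + 4 * δ) + δ →
          ∀ u ∈ U, l (f r z u) ≤ α) → l (Y s' - Y s) ≤ α * (s' - s) + 4 * δ * |α|) ∧
      ∃ σ ∈ Icc 0 T, ∃ y, |σ - t₂| ≤ δ ∧ ‖y - Y t₂‖ ≤ M * (3 * δ) + δ ∧ vbar σ y ≤ 0 := by
  obtain ⟨N, h, x, hh, hhδ, hN, hx0, hst, σ, hσ, yσ, hσ2, hyσ, hvσ⟩ := hE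
  have hst' : ∀ i, ∃ s y u, i < N → (s ∈ Icc 0 T ∧ u ∈ U ∧ |s - (t₁ + i * h)| ≤ δ ∧ ‖y - x i‖ ≤ δ ∧
        x (i+1) = x i + h • f s y u ∧ ‖f s y u‖ ≤ M) := by
    intro i
    by_cases hi : i < N
    · obtain ⟨s, y, u, H⟩ := hst i hi
      exact ⟨s, y, u, fun _ => H⟩
    · exact ⟨0, 0, 0, fun h => absurd h hi⟩
  choose S Z W hSZW using hst'
  let v : ℕ → EuclideanSpace ℝ (Fin n) := fun i => f (S i) (Z i) (W i)
  have hx : ∀ i < N, x (i+1) = x i + h • v i := fun i hi => (hSZW i hi).2.2.2.2.1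
  have hv : ∀ i < N, ‖v i‖ ≤ M := fun i hi => (hSZW i hi).2.2.2.2.2
  let ι : ℝ → ℕ := fun s => min ⌊(s - t₁) / h⌋₊ N
  have hιN : ∀ s, ι s ≤ N := fun s => min_le_right _ _
  have hιm : ∀ s s', s ≤ s' → ι s ≤ ι s' := fun s s' hs =>
    min_le_min_right _ (Nat.floor_mono (by gcongr))
  have hιb : ∀ s, t₁ ≤ s → s ≤ t₂ → |(ι s : ℝ) * h - (s - t₁)| ≤ 2 * δ := by
    intro s hs1 hs2
    have hq : 0 ≤ (s - t₁) / h := div_nonneg (by linarith) hh.le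
    have hf1 : (⌊(s - t₁) / h⌋₊ : ℝ) * h ≤ s - t₁ := by
      have := Nat.floor_le hq
      rwa [le_div_iff₀ hh] at this
    have hf2 : s - t₁ < ((⌊(s - t₁) / h⌋₊ : ℝ) + 1) * h := by
      have := Nat.lt_floor_add_one ((s - t₁) / h)
      rwa [div_lt_iff₀ hh] at this
    rw [abs_le] at hN ⊢
    rcases le_total ⌊(s - t₁) / h⌋₊ N with hc | hc
    · simp only [ι, min_eq_left hc]
      constructor <;> linarith
    · simp only [ι, min_eq_right hc]
      have : (N : ℝ) * h ≤ (⌊(s - t₁) / h⌋₊ : ℝ) * h :=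
        mul_le_mul_of_nonneg_right (by exact_mod_cast hc) hh.le
      constructor <;> linarith
  have hδ : 0 ≤ δ := hh.le.trans hhδ
  refine ⟨fun s => x (ι s), ?_, ?_, ?_, σ, hσ, yσ, hσ2, ?_, hvσ⟩
  · simpa [ι] using hx0
  · intro s s' h1 h2 h3
    refine (aux_disc hh.le hx hv (hιm s s' h2) (hιN s')).trans ?_
    have a1 := abs_le.mp (hιb s h1 (h2.trans h3))
    have a2 := abs_le.mp (hιb s' (h1.trans h2) h3)
    exact mul_le_mul_of_nonneg_left (by linarith) hM
  · intro s s' h1 h2 h3 l α hl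
    have a1 := abs_le.mp (hιb s h1 (h2.trans h3))
    have a2 := abs_le.mp (hιb s' (h1.trans h2) h3)
    have key := aux_disc2 hh.le hx l (α := α) (hιm s s' h2) (hιN s') (by
      intro k hk1 hk2
      have hkN : k < N := hk2.trans_le (hιN s')
      obtain ⟨b1, b2, b3, b4, b5, b6⟩ := hSZW k hkN
      have c1 : (ι s : ℝ) * h ≤ k * h := mul_le_mul_of_nonneg_right (by exact_mod_cast hk1) hh.le
      have c2 : (k : ℝ) * h ≤ ι s' * h :=
        mul_le_mul_of_nonneg_right (by exact_mod_cast hk2.le) hh.le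
      have b3' := abs_le.mp b3
      refine hl _ b1 (abs_le.mpr ⟨by linarith, by linarith⟩) _ ?_ _ b2
      have d1 := aux_disc hh.le hx hv hk1 hkN.le
      have d2 : M * ((k : ℝ) * h - ι s * h) ≤ M * ((s' - s) + 4 * δ) :=
        mul_le_mul_of_nonneg_left (by linarith) hM
      calc ‖Z k - x (ι s)‖ = ‖(x k - x (ι s)) + (Z k - x k)‖ := by congr 1; abel
        _ ≤ _ := norm_add_le _ _
        _ ≤ _ := by linarith)
    refine key.trans ?_
    have e1 : |(ι s' : ℝ) * h - ι s * h - (s' - s)| ≤ 4 * δ :=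
      abs_le.mpr ⟨by linarith, by linarith⟩
    have e2 : α * ((ι s' : ℝ) * h - ι s * h - (s' - s)) ≤ |α| * (4 * δ) :=
      (le_abs_self _).trans (by rw [abs_mul]; exact mul_le_mul_of_nonneg_left e1 (abs_nonneg _))
    linarith
  · have a1 := abs_le.mp (hιb t₂ h12 le_rfl)
    have hN' := abs_le.mp hN
    have d1 := aux_disc hh.le hx hv (hιN t₂) le_rfl
    have d2 : M * ((N : ℝ) * h - ι t₂ * h) ≤ M * (3 * δ) :=
      mul_le_mul_of_nonneg_left (by linarith) hM
    calc ‖yσ - x (ι t₂)‖ = ‖(x N - x (ι t₂)) + (yσ - x N)‖ := by congr 1; abel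
      _ ≤ _ := norm_add_le _ _
      _ ≤ _ := by linarith

lemma aux_limit {n m : ℕ} {T : ℝ} {U : Set (Fin m → ℝ)} (hUc : IsCompact U)
    {f : ℝ → EuclideanSpace ℝ (Fin n) → (Fin m → ℝ) → EuclideanSpace ℝ (Fin n)}
    (hfc : ContinuousOn
      (fun z : ℝ × EuclideanSpace ℝ (Fin n) × (Fin m → ℝ) => f z.1 z.2.1 z.2.2)
      (Set.Icc 0 T ×ˢ (Set.univ : Set (EuclideanSpace ℝ (Fin n))) ×ˢ U))
    (hconv : ∀ s ∈ Set.Icc (0 : ℝ) T, ∀ x, Convex ℝ ((f s x) '' U))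
    {vbar : ℝ → EuclideanSpace ℝ (Fin n) → ℝ}
    (hvc : ContinuousOn (fun z : ℝ × EuclideanSpace ℝ (Fin n) => vbar z.1 z.2)
      (Set.Icc 0 T ×ˢ (Set.univ : Set (EuclideanSpace ℝ (Fin n)))))
    {t₁ t₂ M : ℝ} (h1 : 0 ≤ t₁) (h2 : t₂ ≤ T) (hM : 0 ≤ M) (h12 : t₁ ≤ t₂)
    {xbar : EuclideanSpace ℝ (Fin n)}
    (hY : ∀ δ : ℝ, 0 < δ → ∃ Y : ℝ → EuclideanSpace ℝ (Fin n), ‖Y t₁ - xbar‖ ≤ δ ∧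
      (∀ s s', t₁ ≤ s → s ≤ s' → s' ≤ t₂ → ‖Y s' - Y s‖ ≤ M * ((s' - s) + 4 * δ)) ∧
      (∀ s s', t₁ ≤ s → s ≤ s' → s' ≤ t₂ → ∀ (l : EuclideanSpace ℝ (Fin n) →L[ℝ] ℝ) (α : ℝ),
        (∀ r ∈ Icc 0 T, |r - s| ≤ (s' - s) + 3 * δ → ∀ z, ‖z - Y s‖ ≤ M * ((s' - s) + 4 * δ) + δ →
          ∀ u ∈ U, l (f r z u) ≤ α) → l (Y s' - Y s) ≤ α * (s' - s) + 4 * δ * |α|) ∧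
      ∃ σ ∈ Icc 0 T, ∃ y, |σ - t₂| ≤ δ ∧ ‖y - Y t₂‖ ≤ M * (3 * δ) + δ ∧ vbar σ y ≤ 0) :
    ∃ (C : NNReal) (X : ℝ → EuclideanSpace ℝ (Fin n)), LipschitzWith C X ∧ X t₁ = xbar ∧
      vbar t₂ (X t₂) ≤ 0 ∧
      ∀ s ∈ Ioo t₁ t₂, DifferentiableAt ℝ X s → deriv X s ∈ f s (X s) '' U := by
  let δ : ℕ → ℝ := fun k => 1 / ((k : ℝ) + 1)
  have hδ0 : ∀ k, 0 < δ k := fun k => by positivity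
  have hδ1 : ∀ k, δ k ≤ 1 := fun k => by
    have : (0:ℝ) ≤ k := Nat.cast_nonneg k
    exact (div_le_one (by positivity)).mpr (by linarith)
  let 𝓤 : Filter ℕ := (Filter.hyperfilter ℕ : Filter ℕ)
  have hδt : Filter.Tendsto δ 𝓤 (nhds 0) :=
    tendsto_one_div_add_atTop_nhds_zero_nat.mono_left Nat.hyperfilter_le_atTop
  choose Y hY0 hYL hYI σ hσ y hσt hyY hv using fun k => hY (δ k) (hδ0 k)
  have hlim : ∀ s : ℝ, ∃ X, s ∈ Icc t₁ t₂ → Filter.Tendsto (fun k => Y k s) 𝓤 (nhds X) := by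
    intro s
    by_cases hs : s ∈ Icc t₁ t₂
    · have hK := isCompact_closedBall xbar (1 + M * ((t₂ - t₁) + 4))
      have hmem : ∀ k, Y k s ∈ Metric.closedBall xbar (1 + M * ((t₂ - t₁) + 4)) := by
        intro k
        rw [mem_closedBall_iff_norm]
        have a := hYL k t₁ s le_rfl hs.1 hs.2
        have b := hY0 k
        have c : M * ((s - t₁) + 4 * δ k) ≤ M * ((t₂ - t₁) + 4) :=
          mul_le_mul_of_nonneg_left (by linarith [hs.2, hδ1 k]) hM
        calc ‖Y k s - xbar‖ = ‖(Y k t₁ - xbar) + (Y k s - Y k t₁)‖ := by congr 1; abel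
          _ ≤ _ := norm_add_le _ _
          _ ≤ _ := by linarith [hδ1 k]
      obtain ⟨X, -, hX⟩ := hK.ultrafilter_le_nhds ((Filter.hyperfilter ℕ).map (fun k => Y k s))
        (by
          rw [Filter.le_principal_iff]
          exact Ultrafilter.mem_map.mpr (Filter.univ_mem' hmem))
      exact ⟨X, fun _ => hX⟩
    · exact ⟨0, fun h => absurd h hs⟩
  choose X0 hX0 using hlim
  have hLip : ∀ s s', t₁ ≤ s → s ≤ s' → s' ≤ t₂ → ‖X0 s' - X0 s‖ ≤ M * (s' - s) := by
    intro s s' a b c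
    have l1 := ((hX0 s' ⟨a.trans b, c⟩).sub (hX0 s ⟨a, b.trans c⟩)).norm
    have l2 : Filter.Tendsto (fun k => M * ((s' - s) + 4 * δ k)) 𝓤
        (nhds (M * ((s' - s) + 4 * 0))) := ((hδt.const_mul 4).const_add _).const_mul _
    have := le_of_tendsto_of_tendsto' l1 l2 (fun k => hYL k s s' a b c)
    simpa using this
  let X : ℝ → EuclideanSpace ℝ (Fin n) := fun s => X0 (projIcc t₁ t₂ h12 s)
  have hXe : ∀ s ∈ Icc t₁ t₂, X s = X0 s := fun s hs => by simp [X, projIcc_of_mem h12 hs]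
  obtain ⟨C, hC⟩ : ∃ C : NNReal, (C : ℝ) = M := ⟨⟨M, hM⟩, rfl⟩
  have hXlip : LipschitzWith C X := by
    have : LipschitzWith C (fun s : Icc t₁ t₂ => X0 s) := by
      refine LipschitzWith.of_dist_le_mul fun s s' => ?_
      rw [dist_eq_norm]
      rw [hC]
      show _ ≤ M * |(s : ℝ) - s'|
      rcases le_total (s : ℝ) s' with h | h
      · rw [norm_sub_rev, abs_sub_comm, abs_of_nonneg (by linarith)]
        exact hLip _ _ s.2.1 h s'.2.2
      · rw [abs_of_nonneg (by linarith)]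
        exact hLip _ _ s'.2.1 h s.2.2
    have h3 := this.comp (LipschitzWith.projIcc h12)
    rw [mul_one] at h3
    exact h3
  have m1 : t₁ ∈ Icc t₁ t₂ := ⟨le_rfl, h12⟩
  have m2 : t₂ ∈ Icc t₁ t₂ := ⟨h12, le_rfl⟩
  refine ⟨C, X, hXlip, ?_, ?_, ?_⟩
  · rw [hXe _ m1]
    have l1 := ((hX0 t₁ m1).sub_const xbar).norm
    have := le_of_tendsto_of_tendsto' l1 hδt hY0
    exact sub_eq_zero.mp (norm_le_zero_iff.mp this)
  · rw [hXe _ m2]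
    have ls : Filter.Tendsto σ 𝓤 (nhds t₂) := by
      rw [tendsto_iff_norm_sub_tendsto_zero]
      exact squeeze_zero (fun _ => norm_nonneg _) hσt hδt
    have ly : Filter.Tendsto y 𝓤 (nhds (X0 t₂)) := by
      have l3 : Filter.Tendsto (fun k => y k - Y k t₂) 𝓤 (nhds 0) := by
        rw [tendsto_zero_iff_norm_tendsto_zero]
        refine squeeze_zero (fun _ => norm_nonneg _) hyY ?_
        simpa using ((hδt.const_mul 3).const_mul M).add hδt
      simpa using l3.add (hX0 t₂ m2)
    have lz : Filter.Tendsto (fun k => (σ k, y k)) 𝓤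
        (nhdsWithin (t₂, X0 t₂) (Set.Icc 0 T ×ˢ (Set.univ : Set (EuclideanSpace ℝ (Fin n))))) := by
      refine tendsto_nhdsWithin_iff.mpr ⟨ls.prodMk_nhds ly, ?_⟩
      exact Filter.Eventually.of_forall fun k => ⟨hσ k, mem_univ _⟩
    have := (hvc (t₂, X0 t₂) ⟨⟨h1.trans h12, h2⟩, mem_univ _⟩).tendsto.comp lz
    exact le_of_tendsto' this hv
  · intro s hs hd
    have hsI : s ∈ Icc t₁ t₂ := ⟨hs.1.le, hs.2.le⟩
    have hsT : s ∈ Icc 0 T := ⟨h1.trans hs.1.le, hs.2.le.trans h2⟩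
    by_contra hnot
    have hFc : IsCompact (f s (X s) '' U) := hUc.image_of_continuousOn
      (hfc.comp (f := fun w => (s, X s, w)) (by fun_prop) (fun w hw => ⟨hsT, mem_univ _, hw⟩))
    obtain ⟨l, α, hlα, hαq⟩ := geometric_hahn_banach_closed_point (hconv s hsT (X s))
      hFc.isClosed hnot
    have hev : ∀ᶠ p : ℝ × EuclideanSpace ℝ (Fin n) in nhds (s, X s), ∀ u ∈ U,
        (p.1 ∈ Icc 0 T → u ∈ U → l (f p.1 p.2 u) < α) := by
      refine hUc.eventually_forall_of_forall_eventually ?_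
      intro u hu
      have c1 := (hfc (s, X s, u) ⟨hsT, mem_univ _, hu⟩).tendsto
      have c2 := (l.continuous.tendsto _).comp c1
      have c3 := c2.eventually (gt_mem_nhds (hlα _ (mem_image_of_mem _ hu)))
      rw [eventually_nhdsWithin_iff] at c3
      have c4 : Filter.Tendsto (fun z : (ℝ × EuclideanSpace ℝ (Fin n)) × (Fin m → ℝ) =>
          (z.1.1, z.1.2, z.2)) (nhds ((s, X s), u)) (nhds (s, X s, u)) :=
        Continuous.tendsto (by fun_prop) ((s, X s), u)
      filter_upwards [c4.eventually c3] with z hz a b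
      exact hz ⟨a, mem_univ _, b⟩
    obtain ⟨ρ, hρ, hball⟩ := Metric.eventually_nhds_iff.mp hev
    have hloc : ∀ r ∈ Icc 0 T, |r - s| < ρ → ∀ z, ‖z - X s‖ < ρ → ∀ u ∈ U, l (f r z u) ≤ α := by
      intro r hr a z b u hu
      refine (hball (y := (r, z)) ?_ u hu hr hu).le
      rw [Prod.dist_eq, max_lt_iff, dist_eq_norm, dist_eq_norm]
      exact ⟨a, b⟩
    -- local inequality to the right of `s`
    have hineq : ∀ᶠ s' in nhdsWithin s (Ioi s), l (X s' - X s) ≤ α * (s' - s) := by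
      have e1 : ∀ᶠ s' in nhds s, s' < t₂ := gt_mem_nhds hs.2
      have e2 : ∀ᶠ s' in nhds s, (s' - s) < ρ := by
        have : Filter.Tendsto (fun s' => s' - s) (nhds s) (nhds (s - s)) :=
          Continuous.tendsto (by fun_prop) s
        exact this.eventually (gt_mem_nhds (by simpa using hρ))
      have e3 : ∀ᶠ s' in nhds s, M * (s' - s) < ρ := by
        have : Filter.Tendsto (fun s' => M * (s' - s)) (nhds s) (nhds (M * (s - s))) :=
          Continuous.tendsto (by fun_prop) s
        exact this.eventually (gt_mem_nhds (by simpa using hρ))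
      filter_upwards [nhdsWithin_le_nhds e1, nhdsWithin_le_nhds e2, nhdsWithin_le_nhds e3,
        self_mem_nhdsWithin] with s' f1 f2 f3 f4
      have f4' : s < s' := f4
      have hs'I : s' ∈ Icc t₁ t₂ := ⟨hs.1.le.trans f4'.le, f1.le⟩
      rw [hXe _ hs'I, hXe _ hsI]
      have g1 : ∀ᶠ k in 𝓤, (s' - s) + 3 * δ k < ρ := by
        have : Filter.Tendsto (fun k => (s' - s) + 3 * δ k) 𝓤 (nhds ((s' - s) + 3 * 0)) :=
          (hδt.const_mul 3).const_add _
        exact this.eventually (gt_mem_nhds (by simpa using f2))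
      have g2 : ∀ᶠ k in 𝓤, M * ((s' - s) + 4 * δ k) + δ k + ‖Y k s - X0 s‖ < ρ := by
        have : Filter.Tendsto (fun k => M * ((s' - s) + 4 * δ k) + δ k + ‖Y k s - X0 s‖) 𝓤
            (nhds (M * ((s' - s) + 4 * 0) + 0 + ‖X0 s - X0 s‖)) :=
          ((((hδt.const_mul 4).const_add _).const_mul _).add hδt).add
            ((hX0 s hsI).sub_const _).norm
        exact this.eventually (gt_mem_nhds (by simpa using f3))
      have l1 : Filter.Tendsto (fun k => l (Y k s' - Y k s)) 𝓤 (nhds (l (X0 s' - X0 s))) :=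
        (l.continuous.tendsto _).comp ((hX0 s' hs'I).sub (hX0 s hsI))
      have l2 : Filter.Tendsto (fun k => α * (s' - s) + 4 * δ k * |α|) 𝓤
          (nhds (α * (s' - s) + 4 * 0 * |α|)) :=
        ((hδt.const_mul 4).mul_const _).const_add _
      have := le_of_tendsto_of_tendsto l1 l2 (by
        filter_upwards [g1, g2] with k k1 k2
        refine hYI k s s' hsI.1 f4'.le f1.le l α ?_
        intro r hr a z b u hu
        refine hloc r hr (a.trans_lt k1) z ?_ u hu
        rw [hXe _ hsI]
        calc ‖z - X0 s‖ = ‖(z - Y k s) + (Y k s - X0 s)‖ := by congr 1; abel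
          _ ≤ _ := norm_add_le _ _
          _ < ρ := by linarith)
      simpa using this
    have hder : HasDerivAt (fun r => l (X r)) (l (deriv X s)) s :=
      l.hasFDerivAt.comp_hasDerivAt s hd.hasDerivAt
    have hsl : Filter.Tendsto (slope (fun r => l (X r)) s) (nhdsWithin s (Ioi s))
        (nhds (l (deriv X s))) := (hasDerivAt_iff_tendsto_slope.mp hder).mono_left
      (nhdsWithin_mono s (fun r (hr : s < r) => (ne_of_gt hr : r ≠ s)))
    have : l (deriv X s) ≤ α := by
      refine le_of_tendsto hsl ?_
      filter_upwards [hineq, self_mem_nhdsWithin] with r hr hr'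
      have hr' : s < r := hr'
      rw [slope_def_field, div_le_iff₀ (by linarith)]
      simpa using hr
    linarith

lemma aux_near {n : ℕ} {T R V ε d : ℝ} {vbar : ℝ → EuclideanSpace ℝ (Fin n) → ℝ}
    (hvc : ContinuousOn (fun z : ℝ × EuclideanSpace ℝ (Fin n) => vbar z.1 z.2)
      (Set.Icc 0 T ×ˢ (Set.univ : Set (EuclideanSpace ℝ (Fin n)))))
    (hV : ∀ s ∈ Icc 0 T, ∀ y, ‖y‖ ≤ R → |vbar s y| ≤ V) (hε : 0 < ε) (hd : 0 < d)
    (hεd : 4 * ε * V < d ^ 2) {t : ℝ} {x : EuclideanSpace ℝ (Fin n)} (ht : t ∈ Icc 0 T)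
    (hx : ‖x‖ ≤ R) {c : ℝ}
    (hP : ∃ s ∈ Icc 0 T, ∃ y, ‖y‖ ≤ R ∧ vbar s y + ((t - s)^2 + ‖x - y‖^2) / (2 * ε) ≤ c) :
    ∃ s ∈ Icc 0 T, ∃ y, ‖y‖ ≤ R ∧ vbar s y + ((t - s)^2 + ‖x - y‖^2) / (2 * ε) ≤ c ∧
      |t - s| < d ∧ ‖x - y‖ < d ∧
      ∀ s' ∈ Icc 0 T, ∀ y', ‖y'‖ ≤ R → vbar s y + ((t - s)^2 + ‖x - y‖^2) / (2 * ε) ≤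
        vbar s' y' + ((t - s')^2 + ‖x - y'‖^2) / (2 * ε) := by
  have hK : IsCompact (Icc 0 T ×ˢ Metric.closedBall (0 : EuclideanSpace ℝ (Fin n)) R) :=
    isCompact_Icc.prod (isCompact_closedBall _ _)
  have hcont : ContinuousOn (fun z : ℝ × EuclideanSpace ℝ (Fin n) =>
      vbar z.1 z.2 + ((t - z.1)^2 + ‖x - z.2‖^2) / (2 * ε))
      (Icc 0 T ×ˢ Metric.closedBall (0 : EuclideanSpace ℝ (Fin n)) R) :=
    (hvc.mono (prod_mono_right (subset_univ _))).add (Continuous.continuousOn (by fun_prop))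
  obtain ⟨⟨s, y⟩, ⟨hs, hy⟩, hmin⟩ := hK.exists_isMinOn ⟨(t, x), ht, by simpa using hx⟩ hcont
  have hs : s ∈ Icc 0 T := hs
  have hy : ‖y‖ ≤ R := by simpa using hy
  have hmin' : ∀ s' ∈ Icc 0 T, ∀ y', ‖y'‖ ≤ R → vbar s y + ((t - s)^2 + ‖x - y‖^2) / (2 * ε) ≤
        vbar s' y' + ((t - s')^2 + ‖x - y'‖^2) / (2 * ε) := by
    intro s' hs' y' hy'
    exact hmin (a := (s', y')) ⟨hs', by simpa using hy'⟩
  have hself := hmin' t ht x hx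
  simp only [sub_self, norm_zero, ne_eq, OfNat.ofNat_ne_zero, not_false_eq_true, zero_pow,
    add_zero, zero_div] at hself
  have b1 := abs_le.mp (hV s hs y hy)
  have b2 := abs_le.mp (hV t ht x hx)
  have b3 : ((t - s)^2 + ‖x - y‖^2) / (2 * ε) ≤ 2 * V := by linarith
  rw [div_le_iff₀ (by positivity)] at b3
  have b4 : (t - s)^2 + ‖x - y‖^2 < d ^ 2 := by linarith
  refine ⟨s, hs, y, hy, ?_, ?_, ?_, hmin'⟩
  · obtain ⟨s', hs', y', hy', h⟩ := hP
    exact (hmin' s' hs' y' hy').trans h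
  · exact abs_lt_of_sq_lt_sq (by nlinarith [sq_nonneg ‖x - y‖]) hd.le
  · exact lt_of_pow_lt_pow_left₀ 2 hd.le (by nlinarith [sq_nonneg (t - s)])

lemma aux_kick {n m : ℕ} {T R V ε d : ℝ} {U : Set (Fin m → ℝ)}
    {f : ℝ → EuclideanSpace ℝ (Fin n) → (Fin m → ℝ) → EuclideanSpace ℝ (Fin n)}
    {H : ℝ → EuclideanSpace ℝ (Fin n) → EuclideanSpace ℝ (Fin n) → ℝ}
    (hH : ∀ t ∈ Set.Icc (0 : ℝ) T, ∀ x p,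
      IsGreatest ((fun w => ⟪-p, f t x w⟫) '' U) (H t x p))
    {vbar : ℝ → EuclideanSpace ℝ (Fin n) → ℝ}
    (hvc : ContinuousOn (fun z : ℝ × EuclideanSpace ℝ (Fin n) => vbar z.1 z.2)
      (Set.Icc 0 T ×ˢ (Set.univ : Set (EuclideanSpace ℝ (Fin n)))))
    (hsuper : ∀ t₀ ∈ Set.Ioo (0 : ℝ) T, ∀ x₀, vbar t₀ x₀ < 0 →
      ∀ pt px, IsSubGrad vbar t₀ x₀ pt px → 0 ≤ -pt + H t₀ x₀ px)
    (hV : ∀ s ∈ Icc 0 T, ∀ y, ‖y‖ ≤ R → |vbar s y| ≤ V) (hε : 0 < ε) (hd : 0 < d)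
    (hεd : 4 * ε * V < d ^ 2) {t : ℝ} {x : EuclideanSpace ℝ (Fin n)} (ht1 : d ≤ t) (ht2 : t + d ≤ T)
    (hx : ‖x‖ + d ≤ R) {c : ℝ} (hc : c < 0)
    (hP : ∃ s ∈ Icc 0 T, ∃ y, ‖y‖ ≤ R ∧ vbar s y + ((t - s)^2 + ‖x - y‖^2) / (2 * ε) ≤ c) :
    ∃ s ∈ Icc 0 T, ∃ y, ‖y‖ ≤ R ∧ |t - s| < d ∧ ‖x - y‖ < d ∧ ∃ u ∈ U,
      ∀ h : ℝ, 0 ≤ h → vbar s y + ((t + h - s)^2 + ‖x + h • f s y u - y‖^2) / (2 * ε) ≤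
        c + h^2 * (1 + ‖f s y u‖^2) / (2 * ε) := by
  obtain ⟨s, hs, y, hy, hle, hts, hxy, hmin⟩ := aux_near hvc hV hε hd hεd
    (t := t) (x := x) ⟨by linarith, by linarith⟩ (by linarith) hP
  have hts' := abs_lt.mp hts
  have hsI : s ∈ Ioo 0 T := ⟨by linarith, by linarith⟩
  have hyR : ‖y‖ < R := by
    have : ‖y‖ ≤ ‖x‖ + ‖x - y‖ := by
      calc ‖y‖ = ‖x - (x - y)‖ := by congr 1; abel
        _ ≤ _ := norm_sub_le _ _
    linarith
  have hvneg : vbar s y < 0 := by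
    have : 0 ≤ ((t - s)^2 + ‖x - y‖^2) / (2 * ε) := by positivity
    linarith
  have hsub : IsSubGrad vbar s y ((t - s) / ε) ((1 / ε) • (x - y)) := by
    intro e he
    have e1 : ∀ᶠ z : ℝ × EuclideanSpace ℝ (Fin n) in nhds (s, y), z.1 ∈ Ioo 0 T :=
      (continuous_fst.tendsto (s, y)).eventually (isOpen_Ioo.mem_nhds hsI)
    have e2 : ∀ᶠ z : ℝ × EuclideanSpace ℝ (Fin n) in nhds (s, y), ‖z.2‖ < R :=
      (continuous_snd.norm.tendsto (s, y)).eventually (gt_mem_nhds hyR)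
    have e3 : ∀ᶠ z : ℝ × EuclideanSpace ℝ (Fin n) in nhds (s, y),
        ‖(z.1 - s, z.2 - y)‖ < e * ε := by
      have : Continuous (fun z : ℝ × EuclideanSpace ℝ (Fin n) => ‖(z.1 - s, z.2 - y)‖) := by
        fun_prop
      refine (this.tendsto (s, y)).eventually (gt_mem_nhds ?_)
      simp only [sub_self]
      have h0 : ‖((0 : ℝ), (0 : EuclideanSpace ℝ (Fin n)))‖ = 0 := norm_zero
      rw [h0]; positivity
    filter_upwards [nhdsWithin_le_nhds e1, nhdsWithin_le_nhds e2, nhdsWithin_le_nhds e3] with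
      z hz1 hz2 hz3
    obtain ⟨s', y'⟩ := z
    simp only at hz1 hz2 hz3 ⊢
    have hm := hmin s' ⟨hz1.1.le, hz1.2.le⟩ y' hz2.le
    have n1 : |s' - s| ≤ ‖(s' - s, y' - y)‖ := norm_fst_le (s' - s, y' - y)
    have n2 : ‖y' - y‖ ≤ ‖(s' - s, y' - y)‖ := norm_snd_le (s' - s, y' - y)
    set D := ‖(s' - s, y' - y)‖ with hD
    have hD0 : 0 ≤ D := norm_nonneg _
    have q1 : (s' - s)^2 ≤ D^2 := by
      rw [← sq_abs]; exact pow_le_pow_left₀ (abs_nonneg _) n1 2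
    have q2 : ‖y' - y‖^2 ≤ D^2 := pow_le_pow_left₀ (norm_nonneg _) n2 2
    have q3 : D^2 ≤ e * ε * D := by nlinarith
    have ex : ‖x - y'‖^2 = ‖x - y‖^2 - 2 * ⟪x - y, y' - y⟫ + ‖y' - y‖^2 := by
      rw [← norm_sub_sq_real]; congr 2; abel
    rw [real_inner_smul_left]
    have k1 : ((t - s')^2 + ‖x - y'‖^2) / (2 * ε) = ((t - s)^2 + ‖x - y‖^2) / (2 * ε)
        - ((t - s) / ε * (s' - s) + 1 / ε * ⟪x - y, y' - y⟫)
        + ((s' - s)^2 + ‖y' - y‖^2) / (2 * ε) := by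
      rw [ex]; field_simp; ring
    have k2 : ((s' - s)^2 + ‖y' - y‖^2) / (2 * ε) ≤ e * D := by
      rw [div_le_iff₀ (by positivity)]; nlinarith
    linarith
  have hs0 := hsuper s hsI y hvneg _ _ hsub
  obtain ⟨u, hu, hHu⟩ := (hH s hs y ((1 / ε) • (x - y))).1
  refine ⟨s, hs, y, hy, hts, hxy, u, hu, fun h hh => ?_⟩
  simp only at hHu
  rw [← hHu, inner_neg_left, real_inner_smul_left] at hs0
  have ex : ‖x + h • f s y u - y‖^2 = ‖x - y‖^2 + 2 * (h * ⟪x - y, f s y u⟫)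
      + h^2 * ‖f s y u‖^2 := by
    have : x + h • f s y u - y = (x - y) + h • f s y u := by abel
    rw [this, norm_add_sq_real, real_inner_smul_right, norm_smul, mul_pow, Real.norm_eq_abs, sq_abs]
  have k1 : ((t + h - s)^2 + ‖x + h • f s y u - y‖^2) / (2 * ε)
      = ((t - s)^2 + ‖x - y‖^2) / (2 * ε) - h * (-((t - s) / ε) + -(1 / ε * ⟪x - y, f s y u⟫))
      + h^2 * (1 + ‖f s y u‖^2) / (2 * ε) := by
    rw [ex]; field_simp; ring
  have k2 := mul_nonneg hh hs0
  linarith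

lemma aux_seq {E : Type*} (N : ℕ) (Inv : ℕ → E → Prop) (Rel : ℕ → E → E → Prop)
    (hs : ∀ i < N, ∀ x, Inv i x → ∃ x', Inv (i+1) x' ∧ Rel i x x') (x0 : E) (h0 : Inv 0 x0) :
    ∃ x : ℕ → E, x 0 = x0 ∧ (∀ i ≤ N, Inv i (x i)) ∧ ∀ i < N, Rel i (x i) (x (i+1)) := by
  have hs' : ∀ i x, ∃ x', i < N → Inv i x → (Inv (i+1) x' ∧ Rel i x x') := by
    intro i x
    by_cases h : i < N ∧ Inv i x
    · obtain ⟨x', hx'⟩ := hs i h.1 x h.2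
      exact ⟨x', fun _ _ => hx'⟩
    · exact ⟨x, fun a b => absurd ⟨a, b⟩ h⟩
  choose F hF using hs'
  let x : ℕ → E := fun i => Nat.rec x0 (fun i y => F i y) i
  have hI : ∀ i ≤ N, Inv i (x i) := by
    intro i
    induction i with
    | zero => intro _; exact h0
    | succ i ih => intro hi; exact (hF i (x i) (by omega) (ih (by omega))).1
  exact ⟨x, rfl, hI, fun i hi => (hF i (x i) hi (hI i hi.le)).2⟩

lemma aux_euler {n m : ℕ} {T A : ℝ} {U : Set (Fin m → ℝ)}
    {f : ℝ → EuclideanSpace ℝ (Fin n) → (Fin m → ℝ) → EuclideanSpace ℝ (Fin n)}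
    (hA : 0 ≤ A) (hfA : ∀ s ∈ Icc 0 T, ∀ y, ∀ u ∈ U, ‖f s y u‖ ≤ A * (1 + ‖y‖))
    {H : ℝ → EuclideanSpace ℝ (Fin n) → EuclideanSpace ℝ (Fin n) → ℝ}
    (hH : ∀ t ∈ Set.Icc (0 : ℝ) T, ∀ x p,
      IsGreatest ((fun w => ⟪-p, f t x w⟫) '' U) (H t x p))
    {vbar : ℝ → EuclideanSpace ℝ (Fin n) → ℝ}
    (hvc : ContinuousOn (fun z : ℝ × EuclideanSpace ℝ (Fin n) => vbar z.1 z.2)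
      (Set.Icc 0 T ×ˢ (Set.univ : Set (EuclideanSpace ℝ (Fin n)))))
    (hsuper : ∀ t₀ ∈ Set.Ioo (0 : ℝ) T, ∀ x₀, vbar t₀ x₀ < 0 →
      ∀ pt px, IsSubGrad vbar t₀ x₀ pt px → 0 ≤ -pt + H t₀ x₀ px)
    (hZ : ∀ t ∈ Set.Icc (0 : ℝ) T, ClassZ (vbar t))
    {t₁ t₂ : ℝ} (h1 : 0 ≤ t₁) (h2 : t₂ ≤ T) (h12 : t₁ < t₂)
    {xbar : EuclideanSpace ℝ (Fin n)} (hxb : vbar t₁ xbar ≤ 0)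
    {R M : ℝ} (hR : R = Real.exp (A * T) * (3 + ‖xbar‖)) (hM : M = A * R) {δ : ℝ} (hδ : 0 < δ) :
    ∃ (N : ℕ) (h : ℝ) (x : ℕ → EuclideanSpace ℝ (Fin n)), 0 < h ∧ h ≤ δ ∧
      |N * h - (t₂ - t₁)| ≤ δ ∧ ‖x 0 - xbar‖ ≤ δ ∧
      (∀ i < N, ∃ s y u, s ∈ Icc 0 T ∧ u ∈ U ∧ |s - (t₁ + i * h)| ≤ δ ∧ ‖y - x i‖ ≤ δ ∧
        x (i+1) = x i + h • f s y u ∧ ‖f s y u‖ ≤ M) ∧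
      ∃ σ ∈ Icc 0 T, ∃ y, |σ - t₂| ≤ δ ∧ ‖y - x N‖ ≤ δ ∧ vbar σ y ≤ 0 := by
  have ht1 : t₁ ∈ Icc 0 T := ⟨h1, h12.le.trans h2⟩
  have hT0 : 0 ≤ T := h1.trans ht1.2
  -- starting point
  obtain ⟨x₀, hx₀, hx₀', hvx₀⟩ : ∃ x₀, ‖x₀ - xbar‖ ≤ δ ∧ ‖x₀ - xbar‖ ≤ 1 ∧ vbar t₁ x₀ < 0 := by
    rcases lt_or_eq_of_le hxb with h | h
    · exact ⟨xbar, by simpa using hδ.le, by simp, h⟩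
    · obtain ⟨y, hy, hvy⟩ := hZ t₁ ht1 xbar h (min δ 1) (by positivity)
      rw [mem_ball_iff_norm] at hy
      exact ⟨y, hy.le.trans (min_le_left _ _), hy.le.trans (min_le_right _ _), hvy⟩
  obtain ⟨ρ, hρ, hρv⟩ : ∃ ρ > 0, ∀ τ ∈ Icc 0 T, |τ - t₁| < ρ → vbar τ x₀ < 0 := by
    have hc : ContinuousOn (fun τ => vbar τ x₀) (Icc 0 T) :=
      hvc.comp (f := fun τ => (τ, x₀)) (by fun_prop) (fun τ hτ => ⟨hτ, mem_univ _⟩)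
    have := (hc t₁ ht1).tendsto.eventually (gt_mem_nhds hvx₀)
    rw [eventually_nhdsWithin_iff, Metric.eventually_nhds_iff] at this
    obtain ⟨ρ, hρ, hb⟩ := this
    exact ⟨ρ, hρ, fun τ hτ hd => hb hd hτ⟩
  obtain ⟨η, hη, hη1, hη2, hη3, hη4⟩ : ∃ η > 0, η < ρ ∧ 2 * η ≤ δ ∧ η ≤ 1 ∧ 4 * η ≤ t₂ - t₁ := by
    refine ⟨min (min (ρ / 2) (δ / 2)) (min 1 ((t₂ - t₁) / 4)), ?_, ?_, ?_, ?_, ?_⟩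
    · have : 0 < t₂ - t₁ := by linarith
      positivity
    · have := (min_le_left (min (ρ / 2) (δ / 2)) (min 1 ((t₂ - t₁) / 4))).trans (min_le_left _ _)
      linarith
    · have := (min_le_left (min (ρ / 2) (δ / 2)) (min 1 ((t₂ - t₁) / 4))).trans (min_le_right _ _)
      linarith
    · exact (min_le_right _ _).trans (min_le_left _ _)
    · have := (min_le_right (min (ρ / 2) (δ / 2)) (min 1 ((t₂ - t₁) / 4))).trans (min_le_right _ _)
      linarith
  set a := t₁ + η with ha
  set b := t₂ - η with hb
  have haI : a ∈ Icc 0 T := ⟨by linarith, by linarith⟩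
  have hab : 0 < b - a := by linarith
  have hc0 : vbar a x₀ < 0 := hρv a haI (by rw [ha, add_sub_cancel_left, abs_of_pos hη]; exact hη1)
  set c₀ := vbar a x₀ with hc₀
  -- bound on vbar
  obtain ⟨V, hV0, hV⟩ : ∃ V, 0 ≤ V ∧ ∀ s ∈ Icc 0 T, ∀ y, ‖y‖ ≤ R → |vbar s y| ≤ V := by
    have hK : IsCompact (Icc 0 T ×ˢ Metric.closedBall (0 : EuclideanSpace ℝ (Fin n)) R) :=
      isCompact_Icc.prod (isCompact_closedBall _ _)
    obtain ⟨V, hV⟩ := hK.exists_bound_of_continuousOn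
      (hvc.mono (prod_mono_right (subset_univ _)))
    refine ⟨max V 0, le_max_right _ _, fun s hs y hy => ?_⟩
    exact (hV (s, y) ⟨hs, by simpa using hy⟩).trans (le_max_left _ _)
  obtain ⟨ε, hε, hεd⟩ : ∃ ε > 0, 4 * ε * V < η ^ 2 := by
    refine ⟨η ^ 2 / (4 * (V + 1)), by positivity, ?_⟩
    have : 4 * (η ^ 2 / (4 * (V + 1))) * V = η ^ 2 * (V / (V + 1)) := by field_simp
    rw [this]
    have h3 : V / (V + 1) < 1 := (div_lt_one (by linarith)).mpr (by linarith)
    have h4 : 0 < η ^ 2 := by positivity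
    nlinarith
  -- step size
  obtain ⟨N, h, hN0, hh, hhδ, hNh, hNκ⟩ : ∃ (N : ℕ) (h : ℝ), 0 < N ∧ 0 < h ∧ h ≤ δ ∧
      N * h = b - a ∧ N * (h ^ 2 * (1 + M ^ 2) / (2 * ε)) ≤ - c₀ / 2 := by
    set B := (b - a) * (1 + M ^ 2) / ε with hB
    have hBp : 0 < B := by positivity
    obtain ⟨N, hN⟩ := exists_nat_gt (max ((b - a) / δ) ((b - a) * B / (-c₀)))
    have hNa := (le_max_left _ _).trans_lt hN
    have hNb := (le_max_right _ _).trans_lt hN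
    have hNp : (0 : ℝ) < N := lt_trans (by positivity) hNa
    refine ⟨N, (b - a) / N, by exact_mod_cast hNp, by positivity, ?_, by field_simp, ?_⟩
    · rw [div_lt_iff₀ hδ] at hNa
      rw [div_le_iff₀ hNp]; linarith
    · rw [div_lt_iff₀ (by linarith)] at hNb
      have e1 : (N : ℝ) * (((b - a) / N) ^ 2 * (1 + M ^ 2) / (2 * ε)) = ((b - a) * B / N) / 2 := by
        rw [hB]; field_simp
      rw [e1]
      have : (b - a) * B / N ≤ - c₀ := by rw [div_le_iff₀ hNp]; linarith
      linarith
  set κ := h ^ 2 * (1 + M ^ 2) / (2 * ε) with hκ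
  have hκ0 : 0 ≤ κ := by positivity
  have hR3 : ‖x₀‖ + 2 ≤ 3 + ‖xbar‖ := by
    have : ‖x₀‖ ≤ ‖xbar‖ + ‖x₀ - xbar‖ := by
      calc ‖x₀‖ = ‖xbar + (x₀ - xbar)‖ := by congr 1; abel
        _ ≤ _ := norm_add_le _ _
    linarith
  have hpow : ∀ i ≤ N, (1 + h * A) ^ i * (‖x₀‖ + 2) ≤ R := by
    intro i hi
    have p1 : (1 + h * A) ^ i ≤ Real.exp (A * T) := by
      have q1 : (1 + h * A) ^ i ≤ (Real.exp (h * A)) ^ i := by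
        refine pow_le_pow_left₀ (by positivity) ?_ i
        linarith [Real.add_one_le_exp (h * A)]
      refine q1.trans ?_
      rw [← Real.exp_nat_mul]
      refine Real.exp_le_exp.mpr ?_
      have q2 : (i : ℝ) * h ≤ T := by
        have : (i : ℝ) * h ≤ N * h := mul_le_mul_of_nonneg_right (by exact_mod_cast hi) hh.le
        linarith
      nlinarith
    rw [hR]
    exact mul_le_mul p1 hR3 (by positivity) (Real.exp_pos _).le
  have hih : ∀ i ≤ N, (i : ℝ) * h ≤ b - a := fun i hi => by
    rw [← hNh]; exact mul_le_mul_of_nonneg_right (by exact_mod_cast hi) hh.le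
  have hiκ : ∀ i ≤ N, c₀ + i * κ < 0 := fun i hi => by
    have : (i : ℝ) * κ ≤ N * κ := mul_le_mul_of_nonneg_right (by exact_mod_cast hi) hκ0
    linarith
  obtain ⟨x, hx0, hxI, hxR⟩ := aux_seq N
    (fun i x => ‖x‖ + 2 ≤ (1 + h * A) ^ i * (‖x₀‖ + 2) ∧
      ∃ s ∈ Icc 0 T, ∃ y, ‖y‖ ≤ R ∧
        vbar s y + ((a + i * h - s)^2 + ‖x - y‖^2) / (2 * ε) ≤ c₀ + i * κ)
    (fun i x x' => ∃ s y u, s ∈ Icc 0 T ∧ u ∈ U ∧ |s - (t₁ + i * h)| ≤ δ ∧ ‖y - x‖ ≤ δ ∧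
        x' = x + h • f s y u ∧ ‖f s y u‖ ≤ M)
    (by
      rintro i hi x ⟨hxn, hP⟩
      have hxR := hxn.trans (hpow i hi.le)
      have hihb := hih i hi.le
      have hih0 : 0 ≤ (i : ℝ) * h := by positivity
      obtain ⟨s, hs, y, hy, hts, hxy, u, hu, hstep⟩ := aux_kick hH hvc hsuper hV hε hη hεd
        (t := a + i * h) (x := x) (by linarith) (by linarith) (by linarith) (hiκ i hi.le) hP
      have hyn : ‖y‖ ≤ ‖x‖ + 1 := by
        have : ‖y‖ ≤ ‖x‖ + ‖x - y‖ := by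
          calc ‖y‖ = ‖x - (x - y)‖ := by congr 1; abel
            _ ≤ _ := norm_sub_le _ _
        linarith
      have hf1 : ‖f s y u‖ ≤ A * (‖x‖ + 2) :=
        (hfA s hs y u hu).trans (mul_le_mul_of_nonneg_left (by linarith) hA)
      have hf2 : ‖f s y u‖ ≤ M := by
        rw [hM]; exact hf1.trans (mul_le_mul_of_nonneg_left hxR hA)
      refine ⟨x + h • f s y u, ⟨?_, s, hs, y, hy, ?_⟩, s, y, u, hs, hu, ?_, ?_, rfl, hf2⟩
      · have g1 : ‖x + h • f s y u‖ ≤ ‖x‖ + h * (A * (‖x‖ + 2)) := by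
          refine (norm_add_le _ _).trans ?_
          rw [norm_smul, Real.norm_of_nonneg hh.le]
          have := mul_le_mul_of_nonneg_left hf1 hh.le
          linarith
        have g2 : (1 + h * A) * (‖x‖ + 2) ≤ (1 + h * A) * ((1 + h * A) ^ i * (‖x₀‖ + 2)) :=
          mul_le_mul_of_nonneg_left hxn (by positivity)
        rw [pow_succ]
        linarith
      · have g1 := hstep h hh.le
        have g2 : h^2 * (1 + ‖f s y u‖^2) / (2 * ε) ≤ κ := by
          rw [hκ]; gcongr
        have g3 : a + ((i + 1 : ℕ) : ℝ) * h - s = a + i * h + h - s := by push_cast; ring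
        rw [g3]
        push_cast
        linarith
      · have := abs_lt.mp hts
        exact abs_le.mpr ⟨by linarith, by linarith⟩
      · rw [norm_sub_rev]; linarith)
    x₀ (by
      refine ⟨by simp, a, haI, x₀, ?_, by simp [hc₀]⟩
      have := hpow 0 (Nat.zero_le _)
      simp at this
      linarith)
  refine ⟨N, h, x, hh, hhδ, ?_, by rw [hx0]; exact hx₀, hxR, ?_⟩
  · rw [hNh]; exact abs_le.mpr ⟨by linarith, by linarith⟩
  · obtain ⟨hn, hP⟩ := hxI N le_rfl
    have hnR := hn.trans (hpow N le_rfl)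
    obtain ⟨s, hs, y, hy, hle, hts, hxy, -⟩ := aux_near hvc hV hε hη hεd
      (t := a + N * h) (x := x N) ⟨by rw [hNh]; linarith, by rw [hNh]; linarith⟩ (by linarith) hP
    rw [hNh] at hts hle
    have := abs_lt.mp hts
    refine ⟨s, hs, y, abs_le.mpr ⟨by linarith, by linarith⟩, by rw [norm_sub_rev]; linarith, ?_⟩
    have g1 := hiκ N le_rfl
    have g2 : 0 ≤ ((a + (b - a) - s)^2 + ‖x N - y‖^2) / (2 * ε) := by positivity
    linarith

/-- Recursive feasibility of the under-approximating sets `𝒢̲(t) = {x | v̄(t,x) ≤ 0}`: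
for `t₁ ≤ t₂` in `[0,T]` and `x̄ ∈ 𝒢̲(t₁)` there is an admissible control on `[t₁,t₂]`
driving `x̄` into `𝒢̲(t₂)`. -/
theorem under_approx_BRS_recursive_feasibility {n m : ℕ} (T : ℝ) (hT : 0 < T)
    (U : Set (Fin m → ℝ)) (hUc : IsCompact U) (hUne : U.Nonempty)
    (f : ℝ → EuclideanSpace ℝ (Fin n) → (Fin m → ℝ) → EuclideanSpace ℝ (Fin n))
    (hfc : ContinuousOn
      (fun z : ℝ × EuclideanSpace ℝ (Fin n) × (Fin m → ℝ) => f z.1 z.2.1 z.2.2)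
      (Set.Icc 0 T ×ˢ (Set.univ : Set (EuclideanSpace ℝ (Fin n))) ×ˢ U))
    (L : ℝ) (hL : 0 ≤ L)
    (hfl : ∀ s ∈ Set.Icc (0 : ℝ) T, ∀ w ∈ U, ∀ x y : EuclideanSpace ℝ (Fin n),
      ‖f s x w - f s y w‖ ≤ L * ‖x - y‖)
    (hconv : ∀ s ∈ Set.Icc (0 : ℝ) T, ∀ x, Convex ℝ ((f s x) '' U))
    (H : ℝ → EuclideanSpace ℝ (Fin n) → EuclideanSpace ℝ (Fin n) → ℝ)
    (hH : ∀ t ∈ Set.Icc (0 : ℝ) T, ∀ x p,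
      IsGreatest ((fun w => ⟪-p, f t x w⟫) '' U) (H t x p))
    (g : EuclideanSpace ℝ (Fin n) → ℝ) (hg : Continuous g)
    (vbar : ℝ → EuclideanSpace ℝ (Fin n) → ℝ)
    (hvc : ContinuousOn (fun z : ℝ × EuclideanSpace ℝ (Fin n) => vbar z.1 z.2)
      (Set.Icc 0 T ×ˢ (Set.univ : Set (EuclideanSpace ℝ (Fin n)))))
    (hsuper : ∀ t₀ ∈ Set.Ioo (0 : ℝ) T, ∀ x₀, vbar t₀ x₀ < 0 →
      ∀ pt px, IsSubGrad vbar t₀ x₀ pt px → 0 ≤ -pt + H t₀ x₀ px)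
    (gbar : EuclideanSpace ℝ (Fin n) → ℝ)
    (hterm : ∀ x, vbar T x = gbar x)
    (hZ : ∀ t ∈ Set.Icc (0 : ℝ) T, ClassZ (vbar t))
    (hgbar : ∀ x, ¬ g x ≤ 0 → 0 < gbar x) :
    ∀ t₁ ∈ Set.Icc (0 : ℝ) T, ∀ t₂ ∈ Set.Icc (0 : ℝ) T, t₁ ≤ t₂ →
      ∀ xbar : EuclideanSpace ℝ (Fin n), vbar t₁ xbar ≤ 0 →
        ∃ u X, Admissible U t₁ t₂ u ∧ IsTraj f t₁ t₂ xbar u X ∧ vbar t₂ (X t₂) ≤ 0 := by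
  intro t₁ ht1 t₂ ht2 h12 xbar hxb
  rcases eq_or_lt_of_le h12 with heq | hlt
  · subst heq
    obtain ⟨w, hw⟩ := hUne
    refine ⟨fun _ => w, fun _ => xbar, ⟨measurable_const, fun _ _ => hw⟩,
      ⟨continuousOn_const, fun s hs => ?_⟩, hxb⟩
    have : s = t₁ := le_antisymm hs.2 hs.1
    subst this
    simp
  obtain ⟨B, hB⟩ : ∃ B, ∀ s ∈ Icc 0 T, ∀ u ∈ U, ‖f s 0 u‖ ≤ B := by
    have hc : ContinuousOn (fun z : ℝ × (Fin m → ℝ) => f z.1 0 z.2) (Icc 0 T ×ˢ U) :=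
      hfc.comp (f := fun z : ℝ × (Fin m → ℝ) => (z.1, (0 : EuclideanSpace ℝ (Fin n)), z.2))
        (by fun_prop) (fun z hz => ⟨hz.1, mem_univ _, hz.2⟩)
    obtain ⟨B, hB⟩ := (isCompact_Icc.prod hUc).exists_bound_of_continuousOn hc
    exact ⟨B, fun s hs u hu => hB (s, u) ⟨hs, hu⟩⟩
  have hA : 0 ≤ max B L := hL.trans (le_max_right _ _)
  have hfA : ∀ s ∈ Icc 0 T, ∀ y, ∀ u ∈ U, ‖f s y u‖ ≤ max B L * (1 + ‖y‖) := by
    intro s hs y u hu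
    have e1 := hfl s hs u hu y 0
    rw [sub_zero] at e1
    have e2 := hB s hs u hu
    have e3 : ‖f s y u‖ ≤ ‖f s y u - f s 0 u‖ + ‖f s 0 u‖ := by
      calc ‖f s y u‖ = ‖(f s y u - f s 0 u) + f s 0 u‖ := by congr 1; abel
        _ ≤ _ := norm_add_le _ _
    have e4 : L * ‖y‖ ≤ max B L * ‖y‖ :=
      mul_le_mul_of_nonneg_right (le_max_right _ _) (norm_nonneg _)
    have e5 : B ≤ max B L := le_max_left _ _
    linarith
  have hM : 0 ≤ max B L * (Real.exp (max B L * T) * (3 + ‖xbar‖)) := by positivity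
  obtain ⟨C, X, hX, hX1, hX2, hXin⟩ := aux_limit hUc hfc hconv hvc ht1.1 ht2.2 hM h12
    (xbar := xbar) (fun δ hδ => aux_step hM h12
      (aux_euler hA hfA hH hvc hsuper hZ ht1.1 ht2.2 hlt hxb rfl rfl hδ))
  obtain ⟨u, hu, htr⟩ := aux_traj hUc hUne hfc ht1.1 ht2.2 hX hXin
  rw [hX1] at htr
  exact ⟨u, X, hu, htr, hX2⟩

end
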